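/- Let F be a tk-graph, P an induced J(F)-packing in C([n], k), and H(F) = ∪_i F_i the tk-graph obtained by placing a copy F_i of F on each J_i. If F_i and F_{i'} are two distinct copies of F in H(F), then for every edge F' ∈ F_i one has |F' ∩ V(F_{i'})| ≤ k − 1. Moreover, if F is (2tk − k − 1, 2)-free, then any two distinct edges F', F'' ∈ H(F) satisfy |F' ∩ F''| ≤ k. -/

import Mathlib

open Finset

variable {α : Type*} {β : Type*}

/-- An `r`-graph `H` is `t`-cancellative if for any subfamily `𝒜 ⊆ H` of at most `t` edges and
any two further distinct edges `B, C ∈ H` not in `𝒜`, the symmetric difference of `B` and `C`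
is not contained in the union of the edges of `𝒜`. -/
def IsCancellative [DecidableEq α] (t : ℕ) (H : Finset (Finset α)) : Prop :=
  ∀ 𝒜 ⊆ H, 𝒜.card ≤ t → ∀ B ∈ H, ∀ C ∈ H, B ∉ 𝒜 → C ∉ 𝒜 → B ≠ C →
    ¬((B \ C) ∪ (C \ B) ⊆ 𝒜.sup id)

/-- An `r`-graph `H` is `t`-union-free if any two distinct nonempty subfamilies of `H`, each
consisting of at most `t` edges, have distinct unions. -/
def IsUnionFree [DecidableEq α] (t : ℕ) (H : Finset (Finset α)) : Prop :=
  ∀ 𝒜 ⊆ H, ∀ ℬ ⊆ H, 𝒜.Nonempty → ℬ.Nonempty → 𝒜.card ≤ t → ℬ.card ≤ t → 𝒜 ≠ ℬ →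
    𝒜.sup id ≠ ℬ.sup id

/-- An `r`-graph `H` is `t`-cover-free if no edge of `H` is contained in the union of at most
`t` other edges of `H`. -/
def IsCoverFree [DecidableEq α] (t : ℕ) (H : Finset (Finset α)) : Prop :=
  ∀ 𝒜 ⊆ H, 𝒜.card ≤ t → ∀ B ∈ H, B ∉ 𝒜 → ¬(B ⊆ 𝒜.sup id)

/-- `H` is `(v, e)`-free if any `e` distinct edges of `H` have union of size at least `v + 1`. -/
def IsVEFree [DecidableEq α] (v e : ℕ) (H : Finset (Finset α)) : Prop :=
  ∀ 𝒜 ⊆ H, 𝒜.card = e → v + 1 ≤ (𝒜.sup id).card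

/-- The `k`-shadow of `F`: all `k`-subsets of the vertex set contained in some edge of `F`. -/
def kShadow [DecidableEq α] (k : ℕ) (F : Finset (Finset α)) : Finset (Finset α) :=
  F.sup fun A => Finset.powersetCard k A

/-- `J'` is a copy of `J`: the image of `J` under a map injective on the vertex set of `J`. -/
def IsCopyOf [DecidableEq α] [DecidableEq β] (J' : Finset (Finset β))
    (J : Finset (Finset α)) : Prop :=
  ∃ f : α → β, Set.InjOn f ↑(J.sup id) ∧ J' = J.image fun A => A.image f

/-- The matching number of `H` is at most `b`: every subfamily of pairwise disjoint edges
has at most `b` members. -/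
def MatchingNumberLE [DecidableEq α] (H : Finset (Finset α)) (b : ℕ) : Prop :=
  ∀ M ⊆ H, (∀ A ∈ M, ∀ B ∈ M, A ≠ B → Disjoint A B) → M.card ≤ b

/-- `C_t(n, r)`: the maximum number of edges in an `n`-vertex `t`-cancellative `r`-graph. -/
noncomputable def maxCancellative (t n r : ℕ) : ℕ :=
  sSup {N | ∃ H : Finset (Finset (Fin n)),
    (∀ e ∈ H, e.card = r) ∧ IsCancellative t H ∧ H.card = N}

/-- `U_t(n, r)`: the maximum number of edges in an `n`-vertex `t`-union-free `r`-graph. -/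
noncomputable def maxUnionFree (t n r : ℕ) : ℕ :=
  sSup {N | ∃ H : Finset (Finset (Fin n)),
    (∀ e ∈ H, e.card = r) ∧ IsUnionFree t H ∧ H.card = N}

/-- `F_t(n, r)`: the maximum number of edges in an `n`-vertex `t`-cover-free `r`-graph. -/
noncomputable def maxCoverFree (t n r : ℕ) : ℕ :=
  sSup {N | ∃ H : Finset (Finset (Fin n)),
    (∀ e ∈ H, e.card = r) ∧ IsCoverFree t H ∧ H.card = N}

theorem sup_id_kShadow [DecidableEq α] {k : ℕ} (hk : k ≠ 0) {F : Finset (Finset α)}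
    (hF : ∀ A ∈ F, k ≤ A.card) : (kShadow k F).sup id = F.sup id := by
  ext x
  simp only [kShadow, mem_sup, mem_powersetCard, id]
  constructor
  · rintro ⟨S, ⟨A, hA, hSA, -⟩, hx⟩
    exact ⟨A, hA, hSA hx⟩
  · rintro ⟨A, hA, hx⟩
    obtain ⟨S, hxS, hSA, hS⟩ := exists_subsuperset_card_eq (singleton_subset_iff.2 hx)
      (by rw [card_singleton]; omega) (hF A hA)
    exact ⟨S, ⟨A, hA, hSA, hS⟩, singleton_subset_iff.1 hxS⟩

theorem IsCopyOf.card_eq [DecidableEq α] [DecidableEq β] {G : Finset (Finset β)}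
    {F : Finset (Finset α)} (h : IsCopyOf G F) {r : ℕ} (hF : ∀ A ∈ F, A.card = r) :
    ∀ A ∈ G, A.card = r := by
  obtain ⟨f, hf, rfl⟩ := h
  intro A hA
  obtain ⟨A, hA', rfl⟩ := mem_image.1 hA
  have hsub : A ⊆ F.sup id := le_sup (f := id) hA'
  rw [card_image_of_injOn (hf.mono (coe_subset.2 hsub)), hF A hA']

theorem IsVEFree.of_isCopyOf_two [DecidableEq α] [DecidableEq β] {G : Finset (Finset β)}
    {F : Finset (Finset α)} {v : ℕ} (hF : IsVEFree v 2 F) (h : IsCopyOf G F) :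
    ∀ A ∈ G, ∀ B ∈ G, A ≠ B → v + 1 ≤ (A ∪ B).card := by
  obtain ⟨f, hf, rfl⟩ := h
  intro A hA B hB hAB
  obtain ⟨A, hA', rfl⟩ := mem_image.1 hA
  obtain ⟨B, hB', rfl⟩ := mem_image.1 hB
  have hsub : A ∪ B ⊆ F.sup id := union_subset (le_sup (f := id) hA') (le_sup (f := id) hB')
  have hne : A ≠ B := fun h => hAB (by rw [h])
  have key := hF {A, B} (by simp [insert_subset_iff, hA', hB']) (card_pair hne)
  rw [← image_union, card_image_of_injOn (hf.mono (coe_subset.2 hsub))]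
  simpa using key

/-- For an induced `J(F)`-packing with copies `Fᵢ` of `F` on top: any edge of `Fᵢ` meets the
vertex set of a different copy `F_j` in at most `k - 1` vertices; moreover, if `F` is
`(2tk - k - 1, 2)`-free then any two distinct edges of `H(F)` share at most `k` vertices. -/
theorem copies_small_intersections (t k m n : ℕ) (ht : 2 ≤ t) (hk : 2 ≤ k)
    (F : Finset (Finset (Fin m))) (hF : ∀ A ∈ F, A.card = t * k)
    (hFv : F.sup id = Finset.univ)
    (N : ℕ) (Js : Fin N → Finset (Finset (Fin n)))
    (hcopy : ∀ i, IsCopyOf (Js i) (kShadow k F))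
    (hdisj : ∀ i j, i ≠ j → Disjoint (Js i) (Js j))
    (hind : ∀ i j, i ≠ j →
      ((Js i).sup id ∩ (Js j).sup id).card ≤ k ∧
      (((Js i).sup id ∩ (Js j).sup id).card = k →
        (Js i).sup id ∩ (Js j).sup id ∉ Js i ∧
        (Js i).sup id ∩ (Js j).sup id ∉ Js j))
    (Fs : Fin N → Finset (Finset (Fin n)))
    (hFs : ∀ i, IsCopyOf (Fs i) F ∧ kShadow k (Fs i) = Js i) :
    (∀ i j, i ≠ j → ∀ A ∈ Fs i, (A ∩ (Fs j).sup id).card ≤ k - 1) ∧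
    (IsVEFree (2 * (t * k) - k - 1) 2 F →
      ∀ A ∈ Finset.univ.sup Fs, ∀ B ∈ Finset.univ.sup Fs, A ≠ B →
        (A ∩ B).card ≤ k) := by
  have hk_le : k ≤ t * k := Nat.le_mul_of_pos_left k (by omega)
  have hcard : ∀ i, ∀ A ∈ Fs i, A.card = t * k := fun i => (hFs i).1.card_eq hF
  have hV : ∀ i, (Js i).sup id = (Fs i).sup id := fun i => by
    rw [← (hFs i).2]
    exact sup_id_kShadow (by omega) fun A hA => hk_le.trans_eq (hcard i A hA).symm
  have hsmall : ∀ i j, i ≠ j → ∀ A ∈ Fs i, (A ∩ (Fs j).sup id).card ≤ k - 1 := by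
    intro i j hij A hA
    obtain ⟨hle, hnot⟩ := hind i j hij
    rw [hV i, hV j] at hle hnot
    have hsub : A ∩ (Fs j).sup id ⊆ (Fs i).sup id ∩ (Fs j).sup id :=
      inter_subset_inter_right (le_sup (f := id) hA)
    by_contra! hlt
    have heq := eq_of_subset_of_card_le hsub (by omega)
    have hc : ((Fs i).sup id ∩ (Fs j).sup id).card = k := by
      rw [← heq] at hle ⊢
      omega
    apply (hnot hc).1
    rw [← (hFs i).2, kShadow, mem_sup]
    exact ⟨A, hA, mem_powersetCard.2 ⟨heq ▸ inter_subset_left, hc⟩⟩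
  refine ⟨hsmall, fun hfree A hA B hB hAB => ?_⟩
  obtain ⟨i, -, hA⟩ := mem_sup.1 hA
  obtain ⟨j, -, hB⟩ := mem_sup.1 hB
  by_cases hij : i = j
  · subst hij
    have hunion := hfree.of_isCopyOf_two (hFs i).1 A hA B hB hAB
    have := card_union_add_card_inter A B
    rw [hcard i A hA, hcard i B hB] at this
    omega
  · have hsub : B ⊆ (Fs j).sup id := le_sup (f := id) hB
    calc (A ∩ B).card ≤ (A ∩ (Fs j).sup id).card := card_le_card (inter_subset_inter_left hsub)
      _ ≤ k - 1 := hsmall i j hij A hA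
      _ ≤ k := Nat.sub_le k 1
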